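/- Let H be a closed inverse submonoid of an inverse monoid M and let m ∈ M. Then m ∈ H if and only if m * m⁻¹ ∈ H and (H m)^ω = H, where (H m)^ω = {x ∈ M : h * m ≤ x for some h ∈ H}. (Equivalently: the stabilizer of the base point H under the action of M on right ω-cosets of H is exactly H.) -/

import Mathlib

/-- `i` is the inverse operation of an inverse monoid structure on `M`. -/
def IsInverseMonoidInv (M : Type*) [Monoid M] (i : M → M) : Prop :=
  (∀ a : M, a * i a * a = a) ∧ (∀ a : M, i a * a * i a = i a) ∧
    ∀ a b : M, a * b * a = a → b * a * b = b → b = i a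

/-- The natural partial order on an inverse monoid. -/
def natLe {M : Type*} [Monoid M] (a b : M) : Prop :=
  ∃ e : M, e * e = e ∧ a = e * b

/-- `N^ω`, the set of elements lying above some element of `N`. -/
def omegaClosure {M : Type*} [Monoid M] (N : Set M) : Set M :=
  {m | ∃ n ∈ N, natLe n m}

/-- `H` is a closed inverse submonoid of the inverse monoid `M`. -/
def IsClosedInvSubmonoid {M : Type*} [Monoid M] (i : M → M) (H : Set M) : Prop :=
  (1 : M) ∈ H ∧ (∀ a ∈ H, ∀ b ∈ H, a * b ∈ H) ∧ (∀ a ∈ H, i a ∈ H) ∧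
    omegaClosure H ⊆ H

theorem inv_aux_idem {M : Type*} [Monoid M] (i : M → M)
    (hi : IsInverseMonoidInv M i) (e f : M) (he : e * e = e) (hf : f * f = f) :
    (e * f) * (e * f) = e * f := by
  obtain ⟨h1, h2, h3⟩ := hi
  have a1 := h1 (e * f)
  have a2 := h2 (e * f)
  have he' : ∀ x, e * (e * x) = e * x := fun x => by rw [← mul_assoc, he]
  have hf' : ∀ x, f * (f * x) = f * x := fun x => by rw [← mul_assoc, hf]
  have hb : f * i (e * f) * e = i (e * f) := by
    apply h3
    · simp only [mul_assoc, he', hf'] at a1 ⊢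
      exact a1
    · have := congrArg (fun z => f * z * e) a2
      simp only [mul_assoc, he', hf'] at this ⊢
      exact this
  have hbb : i (e * f) * i (e * f) = i (e * f) := by
    have : (f * i (e * f) * e) * (f * i (e * f) * e) = f * i (e * f) * e := by
      have := congrArg (fun z => f * z * e) a2
      simp only [mul_assoc] at this ⊢
      exact this
    rwa [hb] at this
  have e1 : e * f = i (i (e * f)) := h3 _ _ a2 a1
  have e2 : i (e * f) = i (i (e * f)) := h3 _ _ (by rw [hbb, hbb]) (by rw [hbb, hbb])
  have e3 : e * f = i (e * f) := e1.trans e2.symm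
  rw [← e3] at hbb
  exact hbb

theorem inv_aux_comm {M : Type*} [Monoid M] (i : M → M)
    (hi : IsInverseMonoidInv M i) (e f : M) (he : e * e = e) (hf : f * f = f) :
    e * f = f * e := by
  have p := inv_aux_idem i hi e f he hf
  have q := inv_aux_idem i hi f e hf he
  have he' : ∀ x, e * (e * x) = e * x := fun x => by rw [← mul_assoc, he]
  have hf' : ∀ x, f * (f * x) = f * x := fun x => by rw [← mul_assoc, hf]
  obtain ⟨h1, h2, h3⟩ := hi
  have e1 : e * f = i (e * f) := h3 _ _ (by rw [p, p]) (by rw [p, p])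
  have e2 : f * e = i (e * f) := by
    apply h3
    · simp only [mul_assoc, he', hf'] at p ⊢
      exact p
    · simp only [mul_assoc, he', hf'] at q ⊢
      exact q
  exact e1.trans e2.symm

/-- For a closed inverse submonoid `H` of an inverse monoid `M` and `m ∈ M`:
`m ∈ H` iff `m * m⁻¹ ∈ H` and `(H m)^ω = H`, i.e. the stabilizer of the
base point `H` under the action on right ω-cosets is exactly `H`. -/
theorem mem_iff_coset_fixed {M : Type*} [Monoid M] (i : M → M)
    (hi : IsInverseMonoidInv M i) (H : Set M)
    (hH : IsClosedInvSubmonoid i H) (m : M) :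
    m ∈ H ↔ m * i m ∈ H ∧ omegaClosure ((· * m) '' H) = H := by
  obtain ⟨H1, Hm, Hi, Hc⟩ := hH
  constructor
  · intro hm
    refine ⟨Hm _ hm _ (Hi _ hm), Set.Subset.antisymm ?_ ?_⟩
    · rintro x ⟨_, ⟨h, hh, rfl⟩, hle⟩
      exact Hc ⟨_, Hm _ hh _ hm, hle⟩
    · intro x hx
      have hff : (i m * m) * (i m * m) = i m * m := by
        rw [← mul_assoc, hi.2.1]
      have hgg : (i x * x) * (i x * x) = i x * x := by
        rw [← mul_assoc, hi.2.1]
      have hc := inv_aux_comm i hi _ _ hff hgg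
      have key : x * (i m * m) * i x * x = x * (i m * m) := by
        calc x * (i m * m) * i x * x = x * ((i m * m) * (i x * x)) := by
              simp only [mul_assoc]
          _ = (x * i x * x) * (i m * m) := by rw [hc]; simp only [mul_assoc]
          _ = _ := by rw [hi.1]
      refine ⟨_, ⟨x * i m, Hm _ hx _ (Hi _ hm), rfl⟩, x * (i m * m) * i x, ?_, ?_⟩
      · calc x * (i m * m) * i x * (x * (i m * m) * i x)
            = (x * (i m * m) * i x * x) * (i m * m) * i x := by simp only [mul_assoc]
          _ = x * ((i m * m) * (i m * m)) * i x := by rw [key]; simp only [mul_assoc]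
          _ = _ := by rw [hff]
      · rw [key]; simp only [mul_assoc]
  · rintro ⟨_, h⟩
    rw [← h]
    exact ⟨m, ⟨1, H1, one_mul m⟩, 1, one_mul 1, (one_mul m).symm⟩
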